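/- Let n ≥ 2, let ξ : ℝⁿ → ℝⁿ be a smooth CKV of the flat Euclidean metric with conformal factor ψ, let a₀ ∈ ℝ, and let V, b : ℝⁿ → ℝ be smooth. Assume the potential V satisfies the constraint ξ^k ∂_k V + 2 ψ V + ((2−n)/2) Δψ = 0 and that b solves the Klein–Gordon equation Δb + V b = 0. Then for every smooth solution u of the Klein–Gordon equation Δu + V u = 0, the characteristic function w = ((2−n)/2) ψ u + a₀ u + b − ξ^k ∂_k u also solves Δw + V w = 0. (This is the evolutionary form of the statement that the Lie point symmetries of the Klein–Gordon equation are generated by the CKVs of the metric subject to the potential constraint.) -/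

import Mathlib

/-- Partial derivative `∂f/∂xⁱ` of a function `f : ℝⁿ → ℝ`. -/
noncomputable def pd {n : ℕ} (i : Fin n) (f : (Fin n → ℝ) → ℝ) : (Fin n → ℝ) → ℝ :=
  fun x => fderiv ℝ f x (Pi.single i 1)

/-- The flat Laplacian `Δf = Σ_i ∂²f/∂(xⁱ)²`. -/
noncomputable def lap {n : ℕ} (f : (Fin n → ℝ) → ℝ) : (Fin n → ℝ) → ℝ :=
  fun x => ∑ i, pd i (pd i f) x

theorem pd_smooth {n : ℕ} {f : (Fin n → ℝ) → ℝ} (hf : ContDiff ℝ (⊤ : ℕ∞) f) (i : Fin n) :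
    ContDiff ℝ (⊤ : ℕ∞) (pd i f) := by
  unfold pd
  have h : ContDiff ℝ (⊤ : ℕ∞) (fderiv ℝ f) := hf.fderiv_right (by simp)
  exact h.clm_apply contDiff_const

theorem sm_diff {n : ℕ} {f : (Fin n → ℝ) → ℝ} (hf : ContDiff ℝ (⊤ : ℕ∞) f) :
    Differentiable ℝ f := hf.differentiable (by simp)

theorem pd_add' {n : ℕ} {f g : (Fin n → ℝ) → ℝ} (hf : ContDiff ℝ (⊤ : ℕ∞) f)
    (hg : ContDiff ℝ (⊤ : ℕ∞) g) (i : Fin n) :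
    pd i (fun y => f y + g y) = fun y => pd i f y + pd i g y := by
  funext y
  unfold pd
  rw [fderiv_fun_add (sm_diff hf y) (sm_diff hg y)]
  rfl

theorem pd_mul' {n : ℕ} {f g : (Fin n → ℝ) → ℝ} (hf : ContDiff ℝ (⊤ : ℕ∞) f)
    (hg : ContDiff ℝ (⊤ : ℕ∞) g) (i : Fin n) :
    pd i (fun y => f y * g y) = fun y => pd i f y * g y + f y * pd i g y := by
  funext y
  unfold pd
  rw [fderiv_fun_mul (sm_diff hf y) (sm_diff hg y)]
  simp
  ring

theorem pd_cmul' {n : ℕ} {f : (Fin n → ℝ) → ℝ} (hf : ContDiff ℝ (⊤ : ℕ∞) f)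
    (c : ℝ) (i : Fin n) :
    pd i (fun y => c * f y) = fun y => c * pd i f y := by
  funext y
  unfold pd
  rw [fderiv_const_mul (sm_diff hf y)]
  simp

theorem pd_sum' {n : ℕ} {ι : Type} (s : Finset ι) {f : ι → (Fin n → ℝ) → ℝ}
    (hf : ∀ k, ContDiff ℝ (⊤ : ℕ∞) (f k)) (i : Fin n) :
    pd i (fun y => ∑ k ∈ s, f k y) = fun y => ∑ k ∈ s, pd i (f k) y := by
  funext y
  unfold pd
  rw [fderiv_fun_sum (fun k _ => sm_diff (hf k) y)]
  simp

theorem pd_comm' {n : ℕ} {f : (Fin n → ℝ) → ℝ} (hf : ContDiff ℝ (⊤ : ℕ∞) f)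
    (i j : Fin n) : pd i (pd j f) = pd j (pd i f) := by
  have key : ∀ (i j : Fin n) (x : Fin n → ℝ), pd i (pd j f) x =
      fderiv ℝ (fderiv ℝ f) x (Pi.single i 1) (Pi.single j 1) := by
    intro i j x
    have h : ContDiff ℝ (⊤ : ℕ∞) (fderiv ℝ f) := hf.fderiv_right (by simp)
    have hd : DifferentiableAt ℝ (fderiv ℝ f) x := h.differentiable (by simp) x
    unfold pd
    rw [fderiv_clm_apply hd (differentiableAt_const _)]
    simp
  funext x
  rw [key, key]
  have hs : IsSymmSndFDerivAt ℝ f x :=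
    hf.contDiffAt.isSymmSndFDerivAt (by simp only [minSmoothness_of_isRCLikeNormedField]; exact WithTop.coe_le_coe.2 (le_top : (2 : ℕ∞) ≤ ⊤))
  exact hs _ _

theorem lap_add' {n : ℕ} {f g : (Fin n → ℝ) → ℝ} (hf : ContDiff ℝ (⊤ : ℕ∞) f)
    (hg : ContDiff ℝ (⊤ : ℕ∞) g) (x : Fin n → ℝ) :
    lap (fun y => f y + g y) x = lap f x + lap g x := by
  unfold lap
  rw [← Finset.sum_add_distrib]
  refine Finset.sum_congr rfl fun i _ => ?_
  rw [pd_add' hf hg, pd_add' (pd_smooth hf i) (pd_smooth hg i)]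

theorem lap_cmul' {n : ℕ} {f : (Fin n → ℝ) → ℝ} (hf : ContDiff ℝ (⊤ : ℕ∞) f)
    (c : ℝ) (x : Fin n → ℝ) :
    lap (fun y => c * f y) x = c * lap f x := by
  unfold lap
  rw [Finset.mul_sum]
  refine Finset.sum_congr rfl fun i _ => ?_
  rw [pd_cmul' hf, pd_cmul' (pd_smooth hf i)]

theorem lap_sum' {n : ℕ} {ι : Type} (s : Finset ι) {f : ι → (Fin n → ℝ) → ℝ}
    (hf : ∀ k, ContDiff ℝ (⊤ : ℕ∞) (f k)) (x : Fin n → ℝ) :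
    lap (fun y => ∑ k ∈ s, f k y) x = ∑ k ∈ s, lap (f k) x := by
  unfold lap
  rw [Finset.sum_comm]
  refine Finset.sum_congr rfl fun i _ => ?_
  rw [pd_sum' s hf, pd_sum' s (fun k => pd_smooth (hf k) i)]

theorem lap_mul' {n : ℕ} {f g : (Fin n → ℝ) → ℝ} (hf : ContDiff ℝ (⊤ : ℕ∞) f)
    (hg : ContDiff ℝ (⊤ : ℕ∞) g) (x : Fin n → ℝ) :
    lap (fun y => f y * g y) x
      = lap f x * g x + 2 * (∑ i, pd i f x * pd i g x) + f x * lap g x := by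
  unfold lap
  rw [Finset.sum_mul, Finset.mul_sum, Finset.mul_sum, ← Finset.sum_add_distrib,
    ← Finset.sum_add_distrib]
  refine Finset.sum_congr rfl fun i _ => ?_
  have hf' := pd_smooth hf i
  have hg' := pd_smooth hg i
  rw [pd_mul' hf hg, pd_add' (hf'.mul hg) (hf.mul hg'), pd_mul' hf' hg, pd_mul' hf hg']
  ring

theorem lap_pd' {n : ℕ} {f : (Fin n → ℝ) → ℝ} (hf : ContDiff ℝ (⊤ : ℕ∞) f)
    (k : Fin n) (x : Fin n → ℝ) : lap (pd k f) x = pd k (lap f) x := by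
  have : pd k (lap f) = fun y => ∑ i, pd k (pd i (pd i f)) y :=
    pd_sum' Finset.univ (fun i => pd_smooth (pd_smooth hf i) i) k
  rw [this]
  unfold lap
  refine Finset.sum_congr rfl fun i _ => ?_
  rw [pd_comm' hf i k, pd_comm' (pd_smooth hf i) i k]

/-- Lie point symmetries of the Klein–Gordon equation `Δu + V u = 0` on ℝⁿ
(`n ≥ 2`) in evolutionary form: if `ξ` is a flat CKV with conformal factor `ψ`, the potential
satisfies `ξ^k ∂_k V + 2 ψ V + ((2−n)/2) Δψ = 0`, and `b` solves `Δb + V b = 0`, then for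
every smooth solution `u` of `Δu + V u = 0` the characteristic
`w = ((2−n)/2) ψ u + a₀ u + b − ξ^k ∂_k u` also solves `Δw + V w = 0`. -/
theorem stmt_6 {n : ℕ} (hn : 2 ≤ n)
    (ξ : Fin n → (Fin n → ℝ) → ℝ) (ψ : (Fin n → ℝ) → ℝ)
    (hξ : ∀ i, ContDiff ℝ (⊤ : ℕ∞) (ξ i))
    (hckv : ∀ i j x, pd i (ξ j) x + pd j (ξ i) x =
      2 * ψ x * (if i = j then (1 : ℝ) else 0))
    (a₀ : ℝ) (V b : (Fin n → ℝ) → ℝ)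
    (hV : ContDiff ℝ (⊤ : ℕ∞) V) (hb : ContDiff ℝ (⊤ : ℕ∞) b)
    (hVconstraint : ∀ x, (∑ k, ξ k x * pd k V x) + 2 * ψ x * V x
      + ((2 - (n : ℝ)) / 2) * lap ψ x = 0)
    (hbKG : ∀ x, lap b x + V x * b x = 0) :
    ∀ u : (Fin n → ℝ) → ℝ, ContDiff ℝ (⊤ : ℕ∞) u → (∀ x, lap u x + V x * u x = 0) →
      ∀ x, lap (fun y => ((2 - (n : ℝ)) / 2) * ψ y * u y + a₀ * u y + b y
          - ∑ k, ξ k y * pd k u y) x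
        + V x * (((2 - (n : ℝ)) / 2) * ψ x * u x + a₀ * u x + b x
          - ∑ k, ξ k x * pd k u x) = 0 := by
  intro u hu hKG x
  have hψe : ∀ i, ψ = pd i (ξ i) := by
    intro i; funext y
    have := hckv i i y
    simp at this
    linarith
  have hψ : ContDiff ℝ (⊤ : ℕ∞) ψ := by
    rw [hψe ⟨0, by omega⟩]; exact pd_smooth (hξ _) _
  -- Laplacian of the CKV components
  have hlapξ : ∀ k, lap (ξ k) x = (2 - (n : ℝ)) * pd k ψ x := by
    intro k
    have h1 : ∀ i, pd i (pd i (ξ k)) x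
        = (if i = k then 2 * pd k ψ x else 0) - pd k ψ x := by
      intro i
      have e : pd i (ξ k) = fun y => (2 * (if i = k then (1 : ℝ) else 0)) * ψ y
          + (-1) * pd k (ξ i) y := by
        funext y
        have := hckv i k y
        linarith
      have e2 : pd i (pd k (ξ i)) = pd k ψ := by
        rw [pd_comm' (hξ i), ← hψe i]
      rw [e, pd_add' (contDiff_const.mul hψ) (contDiff_const.mul (pd_smooth (hξ i) k)),
        pd_cmul' hψ, pd_cmul' (pd_smooth (hξ i) k), e2]
      by_cases hik : i = k
      · subst hik; simp; ring
      · simp [hik]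
    unfold lap
    rw [Finset.sum_congr rfl (fun i _ => h1 i), Finset.sum_sub_distrib]
    simp
    ring
  have hlapu : lap u = fun y => (-1) * (V y * u y) := by
    funext y; linarith [hKG y]
  have hsym : 2 * ∑ k, ∑ i, pd i (ξ k) x * pd i (pd k u) x = 2 * ψ x * lap u x := by
    have h2 : ∑ k, ∑ i, pd i (ξ k) x * pd i (pd k u) x
        = ∑ k, ∑ i, pd k (ξ i) x * pd i (pd k u) x := by
      rw [Finset.sum_comm]
      refine Finset.sum_congr rfl fun k _ => Finset.sum_congr rfl fun i _ => ?_
      rw [pd_comm' hu]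
    rw [two_mul]
    nth_rewrite 2 [h2]
    rw [← Finset.sum_add_distrib]
    unfold lap
    rw [Finset.mul_sum]
    refine Finset.sum_congr rfl fun k _ => ?_
    rw [← Finset.sum_add_distrib]
    have : ∀ i, pd i (ξ k) x * pd i (pd k u) x + pd k (ξ i) x * pd i (pd k u) x
        = if i = k then 2 * ψ x * pd i (pd k u) x else 0 := by
      intro i
      rw [← add_mul, hckv]
      split_ifs <;> ring
    rw [Finset.sum_congr rfl (fun i _ => this i)]
    simp
  have hlap3 : ∀ k, lap (pd k u) x = - (pd k V x * u x) - V x * pd k u x := by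
    intro k
    rw [lap_pd' hu, hlapu, pd_cmul' (hV.mul hu), pd_mul' hV hu]
    ring
  have hT : ∀ k, ContDiff ℝ (⊤ : ℕ∞) (fun y => ξ k y * pd k u y) :=
    fun k => (hξ k).mul (pd_smooth hu k)
  have hTs : ContDiff ℝ (⊤ : ℕ∞) (fun y => ∑ k, ξ k y * pd k u y) :=
    ContDiff.sum fun k _ => hT k
  have hlapT : lap (fun y => ∑ k, ξ k y * pd k u y) x
      = (2 - (n : ℝ)) * (∑ k, pd k ψ x * pd k u x) + 2 * ψ x * lap u x
        - (∑ k, ξ k x * pd k V x) * u x - V x * ∑ k, ξ k x * pd k u x := by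
    rw [lap_sum' Finset.univ hT, ← hsym, Finset.mul_sum, Finset.mul_sum, Finset.sum_mul,
      Finset.mul_sum, ← Finset.sum_add_distrib, ← Finset.sum_sub_distrib,
      ← Finset.sum_sub_distrib]
    refine Finset.sum_congr rfl fun k _ => ?_
    rw [lap_mul' (hξ k) (pd_smooth hu k), hlapξ, hlap3]
    ring
  have hw : (fun y => ((2 - (n : ℝ)) / 2) * ψ y * u y + a₀ * u y + b y
          - ∑ k, ξ k y * pd k u y) = fun y => (((((2 - (n : ℝ)) / 2) * (ψ y * u y)) + a₀ * u y)
          + b y) + (-1) * ∑ k, ξ k y * pd k u y := by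
    funext y; ring
  have c1 : ContDiff ℝ (⊤ : ℕ∞) (fun y => ψ y * u y) := hψ.mul hu
  have c2 : ContDiff ℝ (⊤ : ℕ∞) (fun y => ((2 - (n : ℝ)) / 2) * (ψ y * u y)) :=
    contDiff_const.mul c1
  have c3 : ContDiff ℝ (⊤ : ℕ∞) (fun y => a₀ * u y) := contDiff_const.mul hu
  rw [hw, lap_add' ((c2.add c3).add hb) (contDiff_const.mul hTs), lap_add' (c2.add c3) hb,
    lap_add' c2 c3, lap_cmul' c1, lap_cmul' hu, lap_cmul' hTs, lap_mul' hψ hu, hlapT]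
  have hu0 : lap u x = - (V x * u x) := by linarith [hKG x]
  have hb0 : lap b x = - (V x * b x) := by linarith [hbKG x]
  rw [hu0, hb0]
  linear_combination u x * hVconstraint x
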